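/- Let ζ = {ζ_i}_{i∈ℤ} be a switching sequence with ζ_{i+1} − ζ_i ≥ ζ̲ > 0, let q be an even integer, let ω ∈ ℝ, and let 0 < θ < ζ̲/2 be such that |ζ_{i+q} − ζ_i − ω| < θ for all i ∈ ℤ. Then for every k ∈ ℤ and every s ∈ (ζ_k + θ, ζ_{k+1} − θ) one has ν(s + ω, ζ) = ν(s, ζ). -/

import Mathlib

open MeasureTheory Set

noncomputable section

/-- `ℝⁿ` with the Euclidean norm. -/
abbrev Euc (n : ℕ) := EuclideanSpace ℝ (Fin n)

/-- A switching sequence: strictly increasing, with gaps bounded below by `ζlb`,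
tending to `±∞` as `i → ±∞`. -/
def SwitchingSeq (ζ : ℤ → ℝ) (ζlb : ℝ) : Prop :=
  StrictMono ζ ∧ (∀ i : ℤ, ζlb ≤ ζ (i + 1) - ζ i) ∧
    Filter.Tendsto ζ Filter.atTop Filter.atTop ∧
    Filter.Tendsto ζ Filter.atBot Filter.atBot

/-- `ν` is the relay function with values `m0`, `m1` and switching moments `ζ`. -/
def IsRelay {n : ℕ} (ζ : ℤ → ℝ) (m0 m1 : Euc n) (ν : ℝ → Euc n) : Prop :=
  (∀ (i : ℤ) (t : ℝ), ζ (2 * i) < t → t ≤ ζ (2 * i + 1) → ν t = m0) ∧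
  (∀ (i : ℤ) (t : ℝ), ζ (2 * i - 1) < t → t ≤ ζ (2 * i) → ν t = m1)

/-- Bohr almost periodicity of a continuous function. -/
def AlmostPeriodic {V : Type*} [NormedAddCommGroup V] (φ : ℝ → V) : Prop :=
  Continuous φ ∧ ∀ ε : ℝ, 0 < ε → ∃ l : ℝ, 0 < l ∧ ∀ a : ℝ,
    ∃ ω ∈ Set.Icc a (a + l), ∀ t : ℝ, ‖φ (t + ω) - φ t‖ < ε

/-- `f(z,t)` is almost periodic in `t` uniformly for `z ∈ ℝⁿ`. -/
def UnifAlmostPeriodic {n : ℕ} (f : Euc n → ℝ → Euc n) : Prop :=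
  ∀ ε : ℝ, 0 < ε → ∃ l : ℝ, 0 < l ∧ ∀ a : ℝ,
    ∃ ω ∈ Set.Icc a (a + l), ∀ (z : Euc n) (t : ℝ), ‖f z (t + ω) - f z t‖ < ε

/-- The family `{ξ_i^j = ξ_{i+j} - ξ_i}`, `j ∈ ℤ`, is equipotentially almost periodic:
for each `ε > 0` there is a relatively dense set of common `ε`-almost periods. -/
def EquipAP (ξ : ℤ → ℝ) : Prop :=
  ∀ ε : ℝ, 0 < ε → ∃ l : ℝ, 0 < l ∧ ∀ r : ℝ, ∃ p : ℤ, (r ≤ (p : ℝ) ∧ (p : ℝ) ≤ r + l) ∧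
    ∀ i j : ℤ, |(ξ (i + p + j) - ξ (i + p)) - (ξ (i + j) - ξ i)| < ε

/-- A couple of functions is proximal. -/
def Proximal {V : Type*} [NormedAddCommGroup V] (ψ ψ' : ℝ → V) : Prop :=
  ∀ ε : ℝ, 0 < ε → ∀ E : ℝ, 0 < E →
    ∃ a b : ℝ, E ≤ b - a ∧ ∀ t ∈ Set.Icc a b, ‖ψ t - ψ' t‖ < ε

/-- A couple of functions is frequently `(ε, Δ)`-separated: there are infinitely many
pairwise disjoint intervals of length at least `Δ` on which `‖ψ - ψ'‖ > ε`. -/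
def FreqSep {V : Type*} [NormedAddCommGroup V] (ε Δ : ℝ) (ψ ψ' : ℝ → V) : Prop :=
  ∃ a b : ℕ → ℝ, (∀ k, Δ ≤ b k - a k) ∧
    (∀ k l, k ≠ l → Disjoint (Set.Icc (a k) (b k)) (Set.Icc (a l) (b l))) ∧
    ∀ k, ∀ t ∈ Set.Icc (a k) (b k), ε < ‖ψ t - ψ' t‖

/-- A Li-Yorke pair. -/
def LiYorkePair {V : Type*} [NormedAddCommGroup V] (ψ ψ' : ℝ → V) : Prop :=
  Proximal ψ ψ' ∧ ∃ ε₀ Δ : ℝ, 0 < ε₀ ∧ 0 < Δ ∧ FreqSep ε₀ Δ ψ ψ'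

/-- A scrambled set: no almost periodic members, and every couple of distinct members
is a Li-Yorke pair. -/
def ScrambledSet {V : Type*} [NormedAddCommGroup V] (S : Set (ℝ → V)) : Prop :=
  (∀ ψ ∈ S, ¬ AlmostPeriodic ψ) ∧
    ∀ ψ ∈ S, ∀ ψ' ∈ S, ψ ≠ ψ' → LiYorkePair ψ ψ'

/-- A Li-Yorke chaotic set of functions (with almost periodic motions in the basis). -/
def LiYorkeChaotic {V : Type*} [NormedAddCommGroup V] (H : Set (ℝ → V)) : Prop :=
  (∃ C ⊆ H, C.Countable ∧ C.Infinite ∧ ∀ ψ ∈ C, AlmostPeriodic ψ) ∧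
  (∃ S ⊆ H, ¬ S.Countable ∧ ScrambledSet S ∧
    ∀ ψ ∈ S, ∀ ψ' ∈ H, AlmostPeriodic ψ' →
      ∃ ε₀ Δ : ℝ, 0 < ε₀ ∧ 0 < Δ ∧ FreqSep ε₀ Δ ψ ψ')

/-- if `q` is even, `0 < θ < ζ̲/2`, and `|ζ_{i+q} - ζ_i - ω| < θ` for
all `i`, then `ν(s + ω, ζ) = ν(s, ζ)` for every `s ∈ (ζ_k + θ, ζ_{k+1} - θ)`. -/
theorem relay_translation_invariance
    {n : ℕ} (hn : 1 ≤ n)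
    (ζ : ℤ → ℝ) (ζlb : ℝ) (hζlb : 0 < ζlb) (hζ : SwitchingSeq ζ ζlb)
    (m0 m1 : Euc n) (hm01 : m0 ≠ m1) (ν : ℝ → Euc n) (hν : IsRelay ζ m0 m1 ν)
    (q : ℤ) (hq : Even q) (ω θ : ℝ) (hθ : 0 < θ) (hθζ : θ < ζlb / 2)
    (hqω : ∀ i : ℤ, |ζ (i + q) - ζ i - ω| < θ) :
    ∀ k : ℤ, ∀ s : ℝ, ζ k + θ < s → s < ζ (k + 1) - θ → ν (s + ω) = ν s := by
  intro k s hks hsk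
  obtain ⟨h0, h1⟩ := hν
  obtain ⟨r, rfl⟩ := hq
  have hl := abs_lt.mp (hqω k)
  have hr := abs_lt.mp (hqω (k + 1))
  rcases Int.even_or_odd' k with ⟨j, rfl | rfl⟩
  · rw [h0 j s (by linarith) (by linarith)]
    rw [show 2 * j + (r + r) = 2 * (j + r) by ring] at hl
    rw [show 2 * j + 1 + (r + r) = 2 * (j + r) + 1 by ring] at hr
    exact h0 (j + r) _ (by linarith) (by linarith)
  · rw [show 2 * j + 1 + 1 = 2 * (j + 1) by ring] at hr hsk
    rw [show 2 * j + 1 + (r + r) = 2 * (j + 1 + r) - 1 by ring] at hl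
    rw [show 2 * (j + 1) + (r + r) = 2 * (j + 1 + r) by ring] at hr
    rw [show 2 * j + 1 = 2 * (j + 1) - 1 by ring] at hl hks
    rw [h1 (j + 1) s (by linarith) (by linarith)]
    exact h1 (j + 1 + r) _ (by linarith) (by linarith)
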